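/- arXiv:1910.07378 — 2 statements merged into one kernel-verified Lean document; each statement's English description precedes it below -/
import Mathlib

section
/- Let P be a T-invariant probability measure on Ω = ((ℝ^d))^ℤ such that the family of laws {P ∘ S_n^{-1} : n ≥ 0} on ℝ^d is tight. Then P is null-homologous, i.e. there exists a T-invariant probability measure Q on Ω with P = Q ∘ D^{-1}. -/
open MeasureTheory

noncomputable section

abbrev VecD (d : ℕ) := Fin d → ℝ
abbrev SeqD (d : ℕ) := ℤ → VecD d

/-- The left shift on doubly infinite sequences. -/
def shiftT (d : ℕ) : SeqD d → SeqD d := fun x n => x (n + 1)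

/-- The map `D x = T x - x`. -/
def mapD (d : ℕ) : SeqD d → SeqD d := fun x => shiftT d x - x

/-- The partial sums `S_n`. -/
def Spart (d : ℕ) (n : ℤ) (x : SeqD d) : VecD d :=
  if 0 ≤ n then ∑ i ∈ Finset.range n.toNat, x ((i : ℤ) + 1)
  else -∑ i ∈ Finset.range (-n).toNat, x (n + 1 + (i : ℤ))

/-- Tightness of a family of measures. -/
def IsTightFamily {E ι : Type*} [TopologicalSpace E] {m : MeasurableSpace E}
    (μ : ι → Measure E) : Prop :=
  ∀ ε : ℝ, 0 < ε → ∃ K : Set E, IsCompact K ∧ ∀ i, 1 - ENNReal.ofReal ε ≤ μ i K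

/-- A `T`-invariant probability measure is null-homologous if it is the image under `D`
of a `T`-invariant probability measure. -/
def NullHomologous {d : ℕ} (P : Measure (SeqD d)) : Prop :=
  ∃ Q : Measure (SeqD d), IsProbabilityMeasure Q ∧ Q.map (shiftT d) = Q ∧ Q.map (mapD d) = P

/-- The maps `Λ_k`. -/
def Lam (d : ℕ) (k : ℕ) (x : SeqD d) : SeqD d × SeqD d :=
  ((shiftT d)^[k] x, ∑ i ∈ Finset.range k, (shiftT d)^[i] x)

/-- The map `S (x, y) = (T x, x + y)`. -/
def SMap (d : ℕ) : SeqD d × SeqD d → SeqD d × SeqD d := fun p => (shiftT d p.1, p.1 + p.2)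

open Filter Topology Set
open scoped ENNReal BoundedContinuousFunction

section KrylovBogoliubov

variable {X : Type*} [MeasurableSpace X]

/-- The average of the first `N + 1` terms of a sequence of measures. -/
def cesaroMeasure (μ : ℕ → Measure X) (N : ℕ) : Measure X :=
  ((N : ℝ≥0∞) + 1)⁻¹ • ∑ k ∈ Finset.range (N + 1), μ k

lemma cesaroMeasure_apply (μ : ℕ → Measure X) (N : ℕ) (s : Set X) :
    cesaroMeasure μ N s = ((N : ℝ≥0∞) + 1)⁻¹ * ∑ k ∈ Finset.range (N + 1), μ k s := by
  simp [cesaroMeasure, Measure.smul_apply]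

lemma cesaroMeasure_apply_le {μ : ℕ → Measure X} {s : Set X} {c : ℝ≥0∞} (h : ∀ k, μ k s ≤ c)
    (N : ℕ) : cesaroMeasure μ N s ≤ c := by
  rw [cesaroMeasure_apply]
  calc _ ≤ ((N : ℝ≥0∞) + 1)⁻¹ * ∑ _k ∈ Finset.range (N + 1), c := by gcongr; exact h _
    _ = c := by
      rw [Finset.sum_const, Finset.card_range, nsmul_eq_mul, ← mul_assoc, Nat.cast_add_one,
        ENNReal.inv_mul_cancel (by simp) (by finiteness), one_mul]

lemma cesaroMeasure_apply_eq {μ : ℕ → Measure X} {s : Set X} {c : ℝ≥0∞} (h : ∀ k, μ k s = c)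
    (N : ℕ) : cesaroMeasure μ N s = c := by
  rw [cesaroMeasure_apply, Finset.sum_congr rfl fun k _ => h k, Finset.sum_const,
    Finset.card_range, nsmul_eq_mul, ← mul_assoc, Nat.cast_add_one,
    ENNReal.inv_mul_cancel (by simp) (by finiteness), one_mul]

instance isProbabilityMeasure_cesaroMeasure (μ : ℕ → Measure X)
    [∀ k, IsProbabilityMeasure (μ k)] (N : ℕ) : IsProbabilityMeasure (cesaroMeasure μ N) :=
  ⟨cesaroMeasure_apply_eq (fun _ => measure_univ) N⟩

variable [TopologicalSpace X] [BorelSpace X]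

lemma integral_cesaroMeasure (μ : ℕ → Measure X) [∀ k, IsProbabilityMeasure (μ k)] (N : ℕ)
    (f : X →ᵇ ℝ) :
    ∫ x, f x ∂(cesaroMeasure μ N) =
      ((N : ℝ) + 1)⁻¹ * ∑ k ∈ Finset.range (N + 1), ∫ x, f x ∂(μ k) := by
  rw [cesaroMeasure, integral_smul_measure, integral_finsetSum_measure fun k _ => f.integrable _]
  simp [ENNReal.toReal_add]

/-- The Krylov–Bogoliubov argument along a tight orbit of measures. -/
theorem exists_invariant_of_isTightMeasureSet_orbit [T2Space X] [HasOuterApproxClosed X]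
    {Y : Type*} [MeasurableSpace Y] [TopologicalSpace Y] [BorelSpace Y] [HasOuterApproxClosed Y]
    {f : X → X} (hf : Continuous f) {g : X → Y} (hg : Continuous g) {P : Measure Y}
    {μ : ℕ → Measure X} [∀ k, IsProbabilityMeasure (μ k)]
    (hμf : ∀ k, (μ k).map f = μ (k + 1)) (hμg : ∀ k, (μ k).map g = P)
    (htight : IsTightMeasureSet (range μ)) :
    ∃ Q : Measure X, IsProbabilityMeasure Q ∧ Q.map f = Q ∧ Q.map g = P := by
  let q : ℕ → ProbabilityMeasure X := fun N => ⟨cesaroMeasure μ N, inferInstance⟩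
  have hcomp : IsCompact (closure (range q)) := by
    apply isCompact_closure_of_isTightMeasureSet
    rw [isTightMeasureSet_iff_exists_isCompact_measure_compl_le] at htight ⊢
    intro ε hε
    obtain ⟨K, hK, hKε⟩ := htight ε hε
    refine ⟨K, hK, ?_⟩
    rintro _ ⟨_, ⟨N, rfl⟩, rfl⟩
    exact cesaroMeasure_apply_le (fun k => hKε _ ⟨k, rfl⟩) N
  let U : Ultrafilter ℕ := Ultrafilter.of atTop
  have hU : (U : Filter ℕ) ≤ atTop := Ultrafilter.of_le atTop
  obtain ⟨Q, -, hQ⟩ := hcomp.ultrafilter_le_nhds (U.map q)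
    (by
      rw [le_principal_iff]
      exact mem_of_superset (image_mem_map univ_mem) (by simpa using subset_closure))
  replace hQ : Tendsto q U (𝓝 Q) := hQ
  have hQf := ProbabilityMeasure.tendsto_map_of_tendsto_of_continuous q Q hQ hf
  have hQg := ProbabilityMeasure.tendsto_map_of_tendsto_of_continuous q Q hQ hg
  refine ⟨Q, inferInstance, ?_, ?_⟩
  · have key : Tendsto (fun N => (q N).map hf.measurable.aemeasurable) U (𝓝 Q) := by
      rw [ProbabilityMeasure.tendsto_iff_forall_integral_tendsto] at hQ ⊢
      intro φ
      have hdiff : ∀ N, ∫ x, φ x ∂((q N).map hf.measurable.aemeasurable : Measure X) =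
          ∫ x, φ x ∂(q N : Measure X) +
            ((N : ℝ) + 1)⁻¹ * (∫ x, φ x ∂(μ (N + 1)) - ∫ x, φ x ∂(μ 0)) := by
        intro N
        have h1 : ∫ x, φ x ∂((q N).map hf.measurable.aemeasurable : Measure X) =
            ∫ x, (φ.compContinuous ⟨f, hf⟩) x ∂(cesaroMeasure μ N) :=
          integral_map hf.measurable.aemeasurable φ.continuous.aestronglyMeasurable
        have h2 : ∀ k, ∫ x, (φ.compContinuous ⟨f, hf⟩) x ∂(μ k) = ∫ x, φ x ∂(μ (k + 1)) := by
          intro k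
          rw [← hμf k]
          exact (integral_map hf.measurable.aemeasurable
            φ.continuous.aestronglyMeasurable).symm
        have h3 : ∫ x, φ x ∂(q N : Measure X) = ∫ x, φ x ∂(cesaroMeasure μ N) := rfl
        rw [h1, h3, integral_cesaroMeasure, integral_cesaroMeasure, ← mul_add]
        simp only [h2]
        rw [← Finset.sum_range_succ_sub_sum (fun k => ∫ x, φ x ∂(μ k)),
          Finset.sum_range_succ' _ (N + 1)]
        ring
      simp only [hdiff]
      have hzero : Tendsto (fun N : ℕ => ((N : ℝ) + 1)⁻¹ *
          (∫ x, φ x ∂(μ (N + 1)) - ∫ x, φ x ∂(μ 0))) U (𝓝 0) := by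
        have hb : ∀ k, ‖∫ x, φ x ∂(μ k)‖ ≤ ‖φ‖ := fun k => φ.norm_integral_le_norm (μ k)
        refine squeeze_zero_norm (a := fun N : ℕ => ((N : ℝ) + 1)⁻¹ * (‖φ‖ + ‖φ‖)) (fun N => ?_) ?_
        · rw [norm_mul, norm_inv, Real.norm_of_nonneg (by positivity : (0 : ℝ) ≤ (N : ℝ) + 1)]
          gcongr
          exact (norm_sub_le _ _).trans (add_le_add (hb _) (hb _))
        · have h := (tendsto_one_div_add_atTop_nhds_zero_nat (𝕜 := ℝ)).mul_const (‖φ‖ + ‖φ‖)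
          simp only [one_div, zero_mul] at h
          exact h.mono_left hU
      simpa using (hQ φ).add hzero
    have hlim := tendsto_nhds_unique hQf key
    exact congrArg (fun ν : ProbabilityMeasure X => (ν : Measure X)) hlim
  · have hqg : ∀ N, (cesaroMeasure μ N).map g = P := by
      intro N
      ext s hs
      rw [Measure.map_apply hg.measurable hs]
      refine cesaroMeasure_apply_eq (fun k => ?_) N
      rw [← Measure.map_apply hg.measurable hs, hμg]
    have hconst : ∀ N, (q N).map hg.measurable.aemeasurable =
        (q 0).map hg.measurable.aemeasurable :=
      fun N => Subtype.ext ((hqg N).trans (hqg 0).symm)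
    simp only [hconst] at hQg
    have hlim := tendsto_nhds_unique hQg tendsto_const_nhds
    exact (congrArg (fun ν : ProbabilityMeasure Y => (ν : Measure Y)) hlim).trans (hqg 0)

end KrylovBogoliubov

lemma isTightMeasureSet_pi {ι : Type*} [Countable ι] {E : ι → Type*}
    [∀ i, TopologicalSpace (E i)] [∀ i, MeasurableSpace (E i)] {S : Set (Measure (∀ i, E i))}
    (h : ∀ i (ε : ℝ≥0∞), 0 < ε → ∃ K : Set (E i), IsCompact K ∧
      ∀ μ ∈ S, μ ((fun x => x i) ⁻¹' Kᶜ) ≤ ε) : IsTightMeasureSet S := by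
  rw [isTightMeasureSet_iff_exists_isCompact_measure_compl_le]
  intro ε hε
  obtain ⟨δ, hδ, hsum⟩ := ENNReal.exists_pos_sum_of_countable' hε.ne' ι
  choose K hK hKδ using fun i => h i (δ i) (hδ i)
  refine ⟨univ.pi K, isCompact_univ_pi hK, fun μ hμ => ?_⟩
  calc μ (univ.pi K)ᶜ ≤ μ (⋃ i, (fun x => x i) ⁻¹' (K i)ᶜ) := by
        refine measure_mono fun x hx => ?_
        simpa using hx
    _ ≤ ∑' i, μ ((fun x => x i) ⁻¹' (K i)ᶜ) := measure_iUnion_le _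
    _ ≤ ∑' i, δ i := ENNReal.tsum_le_tsum fun i => hKδ i μ hμ
    _ ≤ ε := hsum.le

section Cocycle

variable {d : ℕ}

/-- The shift by an arbitrary integer. -/
def shiftBy (d : ℕ) (m : ℤ) : SeqD d → SeqD d := fun x n => x (n + m)

lemma continuous_shiftBy (m : ℤ) : Continuous (shiftBy d m) :=
  continuous_pi fun n => continuous_apply (n + m)

lemma shiftBy_one : shiftBy d 1 = shiftT d := rfl

lemma shiftBy_comp (m n : ℤ) : shiftBy d m ∘ shiftBy d n = shiftBy d (m + n) := by
  funext x k
  simp [shiftBy, add_assoc]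

lemma shiftBy_zero : shiftBy d 0 = id := by
  funext x k
  simp [shiftBy]

lemma map_shiftBy {P : Measure (SeqD d)} (hT : P.map (shiftT d) = P) (m : ℤ) :
    P.map (shiftBy d m) = P := by
  have hmeas : ∀ m, Measurable (shiftBy d m) := fun m => (continuous_shiftBy m).measurable
  have hneg : P.map (shiftBy d (-1)) = P := by
    conv_lhs => rw [← hT, ← shiftBy_one, Measure.map_map (hmeas _) (hmeas _), shiftBy_comp]
    simp [shiftBy_zero]
  induction m with
  | zero => simp [shiftBy_zero]
  | succ i ih => rw [← shiftBy_comp, ← Measure.map_map (hmeas _) (hmeas _), shiftBy_one, hT, ih]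
  | pred i ih =>
    rw [sub_eq_add_neg, ← shiftBy_comp, ← Measure.map_map (hmeas _) (hmeas _), hneg, ih]

lemma continuous_Spart (n : ℤ) : Continuous (Spart d n) := by
  unfold Spart
  split_ifs <;> fun_prop

lemma Spart_zero (x : SeqD d) : Spart d 0 x = 0 := by simp [Spart]

lemma Spart_add_one (n : ℤ) (x : SeqD d) : Spart d (n + 1) x = Spart d n x + x (n + 1) := by
  rcases lt_trichotomy n (-1) with h | rfl | h
  · obtain ⟨k, hk⟩ : ∃ k : ℕ, n = -(k + 2 : ℤ) := ⟨(-n - 2).toNat, by omega⟩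
    have e1 : (-(n + 1)).toNat = k + 1 := by omega
    have e2 : (-n).toNat = (k + 1) + 1 := by omega
    rw [Spart, Spart, if_neg (by omega), if_neg (by omega), e1, e2,
      Finset.sum_range_succ' _ (k + 1)]
    have e3 : ∀ i : ℕ, n + 1 + ((i + 1 : ℕ) : ℤ) = n + 1 + 1 + i := fun i => by push_cast; ring
    simp only [e3]
    simp
  · simp [Spart]
  · obtain ⟨k, rfl⟩ : ∃ k : ℕ, n = k := ⟨n.toNat, by omega⟩
    have e1 : ((k : ℤ) + 1).toNat = k + 1 := by omega
    rw [Spart, Spart, if_pos (by omega), if_pos (by omega), e1, Int.toNat_natCast,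
      Finset.sum_range_succ]

lemma Spart_add (m n : ℤ) (x : SeqD d) :
    Spart d (m + n) x = Spart d m x + Spart d n (shiftBy d m x) := by
  have hstep : ∀ n : ℤ, Spart d (m + (n + 1)) x - Spart d (n + 1) (shiftBy d m x) =
      Spart d (m + n) x - Spart d n (shiftBy d m x) := by
    intro n
    rw [← add_assoc, Spart_add_one, Spart_add_one, shiftBy,
      show n + 1 + m = m + n + 1 by ring]
    abel
  suffices h : Spart d (m + n) x - Spart d n (shiftBy d m x) = Spart d m x by
    rw [← h]; abel
  induction n with
  | zero => simp [Spart_zero]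
  | succ i ih => rw [hstep, ih]
  | pred i ih => rw [← hstep, sub_add_cancel, ih]

/-- The sequence `z` with `T z - z = x` and `z_m = 0`. -/
def anchoredSum (d : ℕ) (m : ℤ) (x : SeqD d) : SeqD d :=
  fun n => Spart d (n - 1) x - Spart d (m - 1) x

lemma continuous_anchoredSum (m : ℤ) : Continuous (anchoredSum d m) :=
  continuous_pi fun _ => (continuous_Spart _).sub (continuous_Spart _)

lemma mapD_anchoredSum (m : ℤ) (x : SeqD d) : mapD d (anchoredSum d m x) = x := by
  funext n
  have h := Spart_add_one (n - 1) x
  rw [sub_add_cancel] at h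
  simp [mapD, shiftT, anchoredSum, h]

lemma anchoredSum_apply (m n : ℤ) (x : SeqD d) :
    anchoredSum d m x n = Spart d (n - m) (shiftBy d (m - 1) x) := by
  rw [anchoredSum, show n - 1 = (m - 1) + (n - m) by ring, Spart_add, add_sub_cancel_left]

lemma anchoredSum_apply_eq_neg (m n : ℤ) (x : SeqD d) :
    anchoredSum d m x n = -Spart d (m - n) (shiftBy d (n - 1) x) := by
  rw [← anchoredSum_apply, anchoredSum, anchoredSum, neg_sub]

lemma shiftT_anchoredSum (m : ℤ) (x : SeqD d) :
    shiftT d (anchoredSum d m x) = anchoredSum d (m - 1) (shiftT d x) := by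
  funext n
  rw [shiftT, anchoredSum_apply, anchoredSum_apply, ← shiftBy_one, ← Function.comp_apply
    (f := shiftBy d (m - 1 - 1)), shiftBy_comp,
    sub_add_cancel, show n - (m - 1) = n + 1 - m by ring]

lemma isTightMeasureSet_anchoredSum {P : Measure (SeqD d)} [IsProbabilityMeasure P]
    (hT : P.map (shiftT d) = P) (htight : IsTightFamily (fun n : ℕ => P.map (Spart d n)))
    (m : ℕ → ℤ) : IsTightMeasureSet (range fun k => P.map (anchoredSum d (m k))) := by
  refine isTightMeasureSet_pi fun n ε hε => ?_
  obtain ⟨r, hr, hrε⟩ : ∃ r : ℝ, 0 < r ∧ ENNReal.ofReal r ≤ ε := by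
    obtain ⟨r, hr, hrε⟩ := ENNReal.lt_iff_exists_nnreal_btwn.1 hε
    exact ⟨r, by exact_mod_cast hr, by simpa using hrε.le⟩
  obtain ⟨K, hK, hKr⟩ := htight r hr
  have hbound : ∀ (j : ℕ) (l : ℤ), P {x | Spart d j (shiftBy d l x) ∉ K} ≤ ε := by
    intro j l
    have hS := (continuous_Spart (d := d) j).measurable
    have := Measure.isProbabilityMeasure_map (μ := P) hS.aemeasurable
    have h1 : P {x | Spart d j (shiftBy d l x) ∉ K} = (P.map (Spart d j)) Kᶜ := by
      conv_rhs => rw [← map_shiftBy hT l]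
      rw [Measure.map_map hS (continuous_shiftBy l).measurable,
        Measure.map_apply (hS.comp (continuous_shiftBy l).measurable)
          hK.measurableSet.compl]
      rfl
    rw [h1, prob_compl_eq_one_sub hK.measurableSet]
    have := hKr j
    rw [tsub_le_iff_right] at this ⊢
    exact this.trans (by rw [add_comm]; gcongr)
  have hK' : IsCompact (K ∪ -K) := hK.union hK.neg
  refine ⟨K ∪ -K, hK', ?_⟩
  rintro _ ⟨k, rfl⟩
  rw [Measure.map_apply (continuous_anchoredSum _).measurable
    (measurable_pi_apply n hK'.measurableSet.compl)]
  rcases le_total (m k) n with h | h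
  · refine (measure_mono fun x hx => ?_).trans (hbound (n - m k).toNat (m k - 1))
    rw [mem_ofPred_eq, Int.toNat_of_nonneg (by omega), ← anchoredSum_apply]
    exact fun hmem => hx (Or.inl hmem)
  · refine (measure_mono fun x hx => ?_).trans (hbound (m k - n).toNat (n - 1))
    rw [mem_ofPred_eq, Int.toNat_of_nonneg (by omega)]
    refine fun hmem => hx (Or.inr ?_)
    rw [← neg_neg (Spart d _ _), ← anchoredSum_apply_eq_neg] at hmem
    exact hmem

end Cocycle

/-- If the family of laws of `S_n`, `n ≥ 0`, under a `T`-invariant probability measure `P`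
is tight, then `P` is null-homologous. -/
theorem tight_implies_nullHomologous (d : ℕ) (hd : 1 ≤ d) (P : Measure (SeqD d))
    [IsProbabilityMeasure P] (hT : P.map (shiftT d) = P)
    (htight : IsTightFamily (fun n : ℕ => P.map (Spart d n))) :
    ∃ Q : Measure (SeqD d), IsProbabilityMeasure Q ∧ Q.map (shiftT d) = Q ∧
      Q.map (mapD d) = P := by
  have hshift : Continuous (shiftT d) := continuous_shiftBy 1
  have hD : Continuous (mapD d) := hshift.sub continuous_id
  have hmeas : ∀ m, Measurable (anchoredSum d m) := fun m => (continuous_anchoredSum m).measurable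
  have hprob : ∀ k : ℕ, IsProbabilityMeasure (P.map (anchoredSum d (-k))) :=
    fun k => Measure.isProbabilityMeasure_map (hmeas _).aemeasurable
  refine exists_invariant_of_isTightMeasureSet_orbit hshift hD (fun k => ?_) (fun k => ?_)
    (isTightMeasureSet_anchoredSum hT htight fun k => -k)
  · have hcomp : shiftT d ∘ anchoredSum d (-k) = anchoredSum d (-(k + 1 : ℕ)) ∘ shiftT d := by
      funext x
      simp only [Function.comp_apply, shiftT_anchoredSum]
      congr 1
      push_cast
      ring
    rw [Measure.map_map hshift.measurable (hmeas _), hcomp,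
      ← Measure.map_map (hmeas _) hshift.measurable, hT]
  · rw [Measure.map_map hD.measurable (hmeas _)]
    have hid : mapD d ∘ anchoredSum d (-k) = id := funext fun x => mapD_anchoredSum _ x
    rw [hid, Measure.map_id]
end
end

section
/- Let P be a T-invariant probability measure on Ω = ((ℝ^d))^ℤ. Suppose there exists a probability measure Γ on Ω × Ω that is invariant under the map S(x,y) = (Tx, x + y) and whose first marginal (pushforward under (x,y) ↦ x) equals P. Then P is null-homologous, i.e. there exists a T-invariant probability measure Q on Ω with P = Q ∘ D^{-1}. -/
open MeasureTheory

noncomputable section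

theorem measurable_shiftT (d : ℕ) : Measurable (shiftT d) :=
  measurable_pi_lambda _ fun n => measurable_pi_apply (n + 1)

theorem measurable_mapD (d : ℕ) : Measurable (mapD d) :=
  (measurable_shiftT d).sub measurable_id

theorem measurable_SMap (d : ℕ) : Measurable (SMap d) :=
  ((measurable_shiftT d).comp measurable_fst).prodMk (measurable_fst.add measurable_snd)

/-- The map `S` is invertible, with inverse `(x, y) ↦ (T⁻¹ x, y - T⁻¹ x)`. -/
def sMapPerm (d : ℕ) : Equiv.Perm (SeqD d × SeqD d) where
  toFun := SMap d
  invFun p := (fun n => p.1 (n - 1), fun n => p.2 n - p.1 (n - 1))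
  left_inv p := by ext <;> simp [SMap, shiftT]
  right_inv p := by ext <;> simp [SMap, shiftT]

theorem measurable_sMapPerm_inv (d : ℕ) : Measurable ⇑(sMapPerm d)⁻¹ := by
  change Measurable fun p : SeqD d × SeqD d =>
    ((fun n => p.1 (n - 1), fun n => p.2 n - p.1 (n - 1)) : SeqD d × SeqD d)
  fun_prop

theorem measurable_sMapPerm_zpow (d : ℕ) (n : ℤ) : Measurable ⇑(sMapPerm d ^ n) := by
  induction n with
  | zero => exact measurable_id
  | succ n ih =>
    rw [zpow_add_one]
    exact ih.comp (measurable_SMap d)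
  | pred n ih =>
    rw [zpow_sub_one]
    exact ih.comp (measurable_sMapPerm_inv d)

theorem sMapPerm_zpow_fst (d : ℕ) (n k : ℤ) (p : SeqD d × SeqD d) :
    ((sMapPerm d ^ n) p).1 k = p.1 (k + n) := by
  induction n generalizing p with
  | zero => simp
  | succ n ih =>
    rw [zpow_add_one, Equiv.Perm.mul_apply, ih]
    exact congrArg p.1 (by ring)
  | pred n ih =>
    rw [zpow_sub_one, Equiv.Perm.mul_apply, ih]
    exact congrArg p.1 (by ring)

/-- The zeroth coordinate of the second component, observed along the full `S`-orbit. -/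
def orbitSeq (d : ℕ) (p : SeqD d × SeqD d) : SeqD d := fun n => ((sMapPerm d ^ n) p).2 0

theorem measurable_orbitSeq (d : ℕ) : Measurable (orbitSeq d) :=
  measurable_pi_lambda _ fun n =>
    (measurable_pi_apply 0).comp (measurable_snd.comp (measurable_sMapPerm_zpow d n))

theorem shiftT_comp_orbitSeq (d : ℕ) : shiftT d ∘ orbitSeq d = orbitSeq d ∘ SMap d := by
  funext p n
  change ((sMapPerm d ^ (n + 1)) p).2 0 = ((sMapPerm d ^ n) (sMapPerm d p)).2 0
  rw [zpow_add_one, Equiv.Perm.mul_apply]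

theorem mapD_comp_orbitSeq (d : ℕ) : mapD d ∘ orbitSeq d = Prod.fst := by
  funext p n
  change ((sMapPerm d ^ (n + 1)) p).2 0 - ((sMapPerm d ^ n) p).2 0 = p.1 n
  rw [add_comm, zpow_one_add, Equiv.Perm.mul_apply]
  change ((sMapPerm d ^ n) p).1 0 + ((sMapPerm d ^ n) p).2 0 - ((sMapPerm d ^ n) p).2 0 = p.1 n
  rw [add_sub_cancel_right, sMapPerm_zpow_fst, zero_add]

/-- If there is a probability measure `Γ` on `Ω × Ω` invariant under `S(x,y) = (Tx, x+y)`
with first marginal `P`, then the `T`-invariant probability measure `P` is null-homologous. -/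
theorem sMap_invariant_implies_nullHomologous (d : ℕ) (hd : 1 ≤ d) (P : Measure (SeqD d))
    [IsProbabilityMeasure P] (hT : P.map (shiftT d) = P)
    (Γ : Measure (SeqD d × SeqD d)) (hΓ : IsProbabilityMeasure Γ)
    (hS : Γ.map (SMap d) = Γ) (hfst : Γ.map Prod.fst = P) :
    ∃ Q : Measure (SeqD d), IsProbabilityMeasure Q ∧ Q.map (shiftT d) = Q ∧
      Q.map (mapD d) = P := by
  refine ⟨Γ.map (orbitSeq d),
    Measure.isProbabilityMeasure_map (measurable_orbitSeq d).aemeasurable, ?_, ?_⟩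
  · rw [Measure.map_map (measurable_shiftT d) (measurable_orbitSeq d), shiftT_comp_orbitSeq,
      ← Measure.map_map (measurable_orbitSeq d) (measurable_SMap d), hS]
  · rw [Measure.map_map (measurable_mapD d) (measurable_orbitSeq d), mapD_comp_orbitSeq, hfst]
end
end
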